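/- Let a, b, c, k be positive integers. If every type-1 configuration of [a,b,c] admits a proper k-coloring, then every type-2 configuration of [a,b,c] admits a proper 2k-coloring. -/

import Mathlib

/-- A cuboid with integer root and integer dimensions. -/
structure Cuboid where
  root : ℤ × ℤ × ℤ
  dims : ℤ × ℤ × ℤ
deriving DecidableEq

namespace Cuboid

/-- The dimensions are positive. -/
def valid (C : Cuboid) : Prop :=
  0 < C.dims.1 ∧ 0 < C.dims.2.1 ∧ 0 < C.dims.2.2

/-- The closed cuboid `[x,x+a] × [y,y+b] × [z,z+c] ⊆ ℝ³`. -/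
def toSet (C : Cuboid) : Set (ℝ × ℝ × ℝ) :=
  {p | (C.root.1 : ℝ) ≤ p.1 ∧ p.1 ≤ C.root.1 + C.dims.1 ∧
       (C.root.2.1 : ℝ) ≤ p.2.1 ∧ p.2.1 ≤ C.root.2.1 + C.dims.2.1 ∧
       (C.root.2.2 : ℝ) ≤ p.2.2 ∧ p.2.2 ≤ C.root.2.2 + C.dims.2.2}

/-- The open cuboid `(x,x+a) × (y,y+b) × (z,z+c) ⊆ ℝ³` (the interior). -/
def inte (C : Cuboid) : Set (ℝ × ℝ × ℝ) :=
  {p | (C.root.1 : ℝ) < p.1 ∧ p.1 < C.root.1 + C.dims.1 ∧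
       (C.root.2.1 : ℝ) < p.2.1 ∧ p.2.1 < C.root.2.1 + C.dims.2.1 ∧
       (C.root.2.2 : ℝ) < p.2.2 ∧ p.2.2 < C.root.2.2 + C.dims.2.2}

/-- The set `(ℤ×ℤ×ℝ) ∪ (ℤ×ℝ×ℤ) ∪ (ℝ×ℤ×ℤ)` of grid lines. -/
def grid : Set (ℝ × ℝ × ℝ) :=
  {p | ((∃ m : ℤ, p.1 = m) ∧ (∃ n : ℤ, p.2.1 = n)) ∨
       ((∃ m : ℤ, p.1 = m) ∧ (∃ n : ℤ, p.2.2 = n)) ∨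
       ((∃ m : ℤ, p.2.1 = m) ∧ (∃ n : ℤ, p.2.2 = n))}

/-- Two cuboids collide when their interiors intersect. -/
def Collide (C D : Cuboid) : Prop := (C.inte ∩ D.inte).Nonempty

/-- Two cuboids touch when their interiors are disjoint but their intersection
contains a point outside the grid lines (i.e. it is a non-degenerate rectangle). -/
def Touch (C D : Cuboid) : Prop :=
  ¬ Collide C D ∧ ∃ p ∈ C.toSet ∩ D.toSet, p ∉ grid

end Cuboid

/-- A configuration: a finite family of valid pairwise non-colliding cuboids. -/
def IsConfig (F : Finset Cuboid) : Prop :=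
  (∀ C ∈ F, C.valid) ∧ ∀ C ∈ F, ∀ D ∈ F, C ≠ D → ¬ Cuboid.Collide C D

/-- A type-1 configuration of `[a,b,c]`: every cuboid has dimensions exactly `(a,b,c)`. -/
def Type1 (a b c : ℕ) (F : Finset Cuboid) : Prop :=
  ∀ C ∈ F, C.dims = ((a : ℤ), (b : ℤ), (c : ℤ))

/-- A type-2 configuration of `[a,b,c]`: every cuboid has dimensions `(a,b,c)` or `(b,a,c)`. -/
def Type2 (a b c : ℕ) (F : Finset Cuboid) : Prop :=
  ∀ C ∈ F, C.dims = ((a : ℤ), (b : ℤ), (c : ℤ)) ∨ C.dims = ((b : ℤ), (a : ℤ), (c : ℤ))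

/-- A type-3 configuration of `[a,b,c]`: every cuboid's dimensions are a permutation of `(a,b,c)`. -/
def Type3 (a b c : ℕ) (F : Finset Cuboid) : Prop :=
  ∀ C ∈ F, C.dims = ((a : ℤ), (b : ℤ), (c : ℤ)) ∨ C.dims = ((a : ℤ), (c : ℤ), (b : ℤ)) ∨
    C.dims = ((b : ℤ), (a : ℤ), (c : ℤ)) ∨ C.dims = ((b : ℤ), (c : ℤ), (a : ℤ)) ∨
    C.dims = ((c : ℤ), (a : ℤ), (b : ℤ)) ∨ C.dims = ((c : ℤ), (b : ℤ), (a : ℤ))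

/-- A proper `k`-coloring of a configuration: touching cuboids get distinct colors. -/
def ProperColoring (k : ℕ) (F : Finset Cuboid) : Prop :=
  ∃ κ : Cuboid → Fin k, ∀ C ∈ F, ∀ D ∈ F, Cuboid.Touch C D → κ C ≠ κ D

namespace Cuboid

/-- The reflection of a cuboid exchanging the first two coordinates. -/
def swap (C : Cuboid) : Cuboid :=
  ⟨(C.root.2.1, C.root.1, C.root.2.2), (C.dims.2.1, C.dims.1, C.dims.2.2)⟩

theorem valid.swap {C : Cuboid} (h : C.valid) : C.swap.valid := ⟨h.2.1, h.1, h.2.2⟩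

theorem Collide.swap {C D : Cuboid} (h : Collide C D) : Collide C.swap D.swap := by
  obtain ⟨⟨x, y, z⟩, ⟨hx, hx', hy, hy', hz⟩, ⟨kx, kx', ky, ky', kz⟩⟩ := h
  exact ⟨(y, x, z), ⟨hy, hy', hx, hx', hz⟩, ⟨ky, ky', kx, kx', kz⟩⟩

theorem Touch.swap {C D : Cuboid} (h : Touch C D) : Touch C.swap D.swap := by
  obtain ⟨hn, ⟨x, y, z⟩, ⟨⟨hx, hx', hy, hy', hz⟩, ⟨kx, kx', ky, ky', kz⟩⟩, hg⟩ := h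
  refine ⟨fun hc => hn hc.swap, (y, x, z),
    ⟨⟨hy, hy', hx, hx', hz⟩, ⟨ky, ky', kx, kx', kz⟩⟩, fun hp => hg ?_⟩
  rcases hp with ⟨p, q⟩ | ⟨p, q⟩ | ⟨p, q⟩
  · exact Or.inl ⟨q, p⟩
  · exact Or.inr (Or.inr ⟨p, q⟩)
  · exact Or.inr (Or.inl ⟨p, q⟩)

end Cuboid

theorem IsConfig.mono {F G : Finset Cuboid} (hF : IsConfig F) (hGF : G ⊆ F) : IsConfig G :=
  ⟨fun C hC => hF.1 C (hGF hC), fun C hC D hD => hF.2 C (hGF hC) D (hGF hD)⟩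

theorem IsConfig.image_swap {F : Finset Cuboid} (hF : IsConfig F) :
    IsConfig (F.image Cuboid.swap) := by
  simp only [IsConfig, Finset.forall_mem_image]
  exact ⟨fun C hC => (hF.1 C hC).swap,
    fun C hC D hD hne hcol => hF.2 C hC D hD (fun e => hne (e ▸ rfl)) hcol.swap⟩

/-- If every type-1 configuration of `[a,b,c]` is properly `k`-colorable, then every
type-2 configuration of `[a,b,c]` is properly `2k`-colorable. -/
theorem type2_coloring_of_type1
    (a b c k : ℕ) (ha : 0 < a) (hb : 0 < b) (hc : 0 < c) (hk : 0 < k)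
    (h : ∀ F : Finset Cuboid, IsConfig F → Type1 a b c F → ProperColoring k F) :
    ∀ F : Finset Cuboid, IsConfig F → Type2 a b c F → ProperColoring (2 * k) F := by
  intro F hF hT
  let P : Cuboid → Prop := fun C => C.dims = ((a : ℤ), (b : ℤ), (c : ℤ))
  obtain ⟨κ, hκ⟩ := h (F.filter P) (hF.mono (Finset.filter_subset _ _))
    (fun C hC => (Finset.mem_filter.1 hC).2)
  obtain ⟨μ, hμ⟩ := h ((F.filter (¬ P ·)).image Cuboid.swap)
    (hF.mono (Finset.filter_subset _ _)).image_swap (by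
      simp only [Type1, Finset.forall_mem_image, Finset.mem_filter]
      rintro C ⟨hC, hP⟩
      simp [Cuboid.swap, (hT C hC).resolve_left hP])
  refine ⟨fun C => finProdFinEquiv (if P C then (0, κ C) else (1, μ C.swap)), ?_⟩
  intro C hC D hD hCD
  rw [finProdFinEquiv.injective.ne_iff]
  by_cases hPC : P C <;> by_cases hPD : P D <;> simp only [hPC, hPD, if_true, if_false]
  · simpa using hκ C (by simp [hC, hPC]) D (by simp [hD, hPD]) hCD
  · simp
  · simp
  · simpa using hμ C.swap (Finset.mem_image_of_mem _ (by simp [hC, hPC]))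
      D.swap (Finset.mem_image_of_mem _ (by simp [hD, hPD])) hCD.swap
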